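/- arXiv:1506.07683 — 8 statements merged into one kernel-verified Lean document; each statement's English description precedes it below -/
import Mathlib

section
/- Let a > 0, b > 0 and t₀ be real numbers, and define f : ℝ → ℝ by f(t) = (1/a)·arsinh(e^{−a²·b·t}·sinh(a·t₀)). Then f(0) = t₀ and f is differentiable with f′(t) = −a·b·tanh(a·f(t)) for every t ∈ ℝ. -/
/-- The explicit function `f(t) = (1/a)·arsinh(e^{−a²bt}·sinh(a t₀))` satisfies `f 0 = t₀`
and solves the ODE `f′(t) = −a·b·tanh(a·f(t))`. -/
theorem stmt_0 (a b t₀ : ℝ) (ha : 0 < a) (hb : 0 < b) (f : ℝ → ℝ)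
    (hf : ∀ t, f t = (1 / a) * Real.arsinh (Real.exp (-(a ^ 2 * b * t)) * Real.sinh (a * t₀))) :
    f 0 = t₀ ∧ ∀ t, HasDerivAt f (-(a * b * Real.tanh (a * f t))) t := by
  have ha' : a ≠ 0 := ha.ne'
  refine ⟨by simp [hf, ha'], fun t => ?_⟩
  have haf : a * f t = Real.arsinh (Real.exp (-(a ^ 2 * b * t)) * Real.sinh (a * t₀)) := by
    rw [hf]
    field_simp
  have hderiv := (((((hasDerivAt_id t).const_mul (a ^ 2 * b)).neg.exp.mul_const
    (Real.sinh (a * t₀))).arsinh).const_mul (1 / a))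
  rw [haf, Real.tanh_arsinh, funext hf]
  refine hderiv.congr_deriv ?_
  simp only [Pi.neg_apply, id_eq, smul_eq_mul]
  field_simp
end

section
/- Let a > 0, b > 0 and t₀ be real numbers. If c : ℝ → ℝ is differentiable, c(0) = t₀, and c′(t) = −a·b·tanh(a·c(t)) for every t ∈ ℝ, then c(t) = (1/a)·arsinh(e^{−a²·b·t}·sinh(a·t₀)) for every t ∈ ℝ. -/
/-- Along a solution of `c′ = −a·b·tanh(a·c)`, the quantity `e^{a²bt}·sinh(a c(t))` is
conserved. -/
theorem hasDerivAt_exp_mul_sinh_of_tanh_ode {a b t : ℝ} {c : ℝ → ℝ}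
    (hode : HasDerivAt c (-(a * b * Real.tanh (a * c t))) t) :
    HasDerivAt (fun s => Real.exp (a ^ 2 * b * s) * Real.sinh (a * c s)) 0 t := by
  have hexp := ((hasDerivAt_id t).const_mul (a ^ 2 * b)).exp
  have hsinh := (hode.const_mul a).sinh
  refine (hexp.mul hsinh).congr_deriv ?_
  have hcosh : Real.cosh (a * c t) ≠ 0 := (Real.cosh_pos _).ne'
  rw [Real.tanh_eq_sinh_div_cosh]
  simp only [id]
  field_simp
  ring

/-- Uniqueness: any differentiable solution of `c′(t) = −a·b·tanh(a·c(t))` with `c 0 = t₀`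
is given by the explicit formula `(1/a)·arsinh(e^{−a²bt}·sinh(a t₀))`. -/
theorem stmt_1 (a b t₀ : ℝ) (ha : 0 < a) (hb : 0 < b) (c : ℝ → ℝ)
    (hdiff : Differentiable ℝ c) (h0 : c 0 = t₀)
    (hode : ∀ t, HasDerivAt c (-(a * b * Real.tanh (a * c t))) t) :
    ∀ t, c t = (1 / a) * Real.arsinh (Real.exp (-(a ^ 2 * b * t)) * Real.sinh (a * t₀)) := by
  intro t
  have hderiv s := hasDerivAt_exp_mul_sinh_of_tanh_ode (hode s)
  have hconst := is_const_of_deriv_eq_zero (fun s => (hderiv s).differentiableAt)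
    (fun s => (hderiv s).deriv) 0 t
  simp only [mul_zero, Real.exp_zero, one_mul, h0] at hconst
  rw [hconst, ← mul_assoc, ← Real.exp_add, neg_add_cancel, Real.exp_zero, one_mul,
    Real.arsinh_sinh]
  field_simp
end

section
/- Let a > 0 and b > 0 be real numbers and let c : ℝ → ℝ be differentiable with c′(t) = −a·b·tanh(a·c(t)) for every t ∈ ℝ. Then sinh(a·c(t)) = e^{−a²·b·t}·sinh(a·c(0)) for every t ∈ ℝ; equivalently, t ↦ e^{a²·b·t}·sinh(a·c(t)) is constant. -/
/-- Conserved quantity for the ODE `c′(t) = −a·b·tanh(a·c(t))`: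
`sinh(a·c(t)) = e^{−a²bt}·sinh(a·c(0))`, i.e. `t ↦ e^{a²bt}·sinh(a·c(t))` is constant. -/
theorem stmt_2 (a b : ℝ) (ha : 0 < a) (hb : 0 < b) (c : ℝ → ℝ)
    (hode : ∀ t, HasDerivAt c (-(a * b * Real.tanh (a * c t))) t) :
    (∀ t, Real.sinh (a * c t) = Real.exp (-(a ^ 2 * b * t)) * Real.sinh (a * c 0)) ∧
      ∀ t, Real.exp (a ^ 2 * b * t) * Real.sinh (a * c t) = Real.sinh (a * c 0) := by
  have hconst : ∀ t,
      Real.exp (a ^ 2 * b * t) * Real.sinh (a * c t) = Real.sinh (a * c 0) := by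
    have hderiv : ∀ t, HasDerivAt
        (fun t => Real.exp (a ^ 2 * b * t) * Real.sinh (a * c t)) 0 t := by
      intro t
      have hexp := ((hasDerivAt_id t).const_mul (a ^ 2 * b)).exp
      have hsinh := ((hode t).const_mul a).sinh
      refine (hexp.mul hsinh).congr_deriv ?_
      have hcosh : Real.cosh (a * c t) ≠ 0 := (Real.cosh_pos _).ne'
      simp only [id, Real.tanh_eq_sinh_div_cosh]
      field_simp
      ring
    intro t
    simpa using is_const_of_deriv_eq_zero (fun x => (hderiv x).differentiableAt)
      (fun x => (hderiv x).deriv) t 0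
  refine ⟨fun t => ?_, hconst⟩
  rw [← hconst t, ← mul_assoc, ← Real.exp_add, neg_add_cancel, Real.exp_zero, one_mul]
end

section
/- Let a > 0, b > 0 and t₀ be real numbers, and define f : ℝ → ℝ by f(t) = (1/a)·arsinh(e^{−a²·b·t}·sinh(a·t₀)). If t₀ > 0 then f is strictly decreasing and f(t) > 0 for all t; if t₀ < 0 then f is strictly increasing and f(t) < 0 for all t; and if t₀ = 0 then f(t) = 0 for all t. -/
/-- Monotonicity/sign behaviour of the explicit solution depending on the sign of `t₀`. -/
theorem stmt_6 (a b t₀ : ℝ) (ha : 0 < a) (hb : 0 < b) (f : ℝ → ℝ)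
    (hf : ∀ t, f t = (1 / a) * Real.arsinh (Real.exp (-(a ^ 2 * b * t)) * Real.sinh (a * t₀))) :
    (0 < t₀ → StrictAnti f ∧ ∀ t, 0 < f t) ∧
      (t₀ < 0 → StrictMono f ∧ ∀ t, f t < 0) ∧
      (t₀ = 0 → ∀ t, f t = 0) := by
  have h_inv : 0 < 1 / a := one_div_pos.2 ha
  have h_exp : StrictAnti fun t : ℝ => Real.exp (-(a ^ 2 * b * t)) := fun s t hst =>
    Real.exp_lt_exp.2 (neg_lt_neg (mul_lt_mul_of_pos_left hst (by positivity)))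
  refine ⟨fun h => ?_, fun h => ?_, fun h t => by simp [hf, h]⟩
  · have h_sinh : 0 < Real.sinh (a * t₀) := Real.sinh_pos_iff.2 (mul_pos ha h)
    refine ⟨fun s t hst => ?_, fun t => ?_⟩
    · rw [hf, hf]
      exact mul_lt_mul_of_pos_left
        (Real.arsinh_lt_arsinh.2 (mul_lt_mul_of_pos_right (h_exp hst) h_sinh)) h_inv
    · rw [hf]
      exact mul_pos h_inv (Real.arsinh_pos_iff.2 (mul_pos (Real.exp_pos _) h_sinh))
  · have h_sinh : Real.sinh (a * t₀) < 0 := Real.sinh_neg_iff.2 (mul_neg_of_pos_of_neg ha h)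
    refine ⟨fun s t hst => ?_, fun t => ?_⟩
    · rw [hf, hf]
      exact mul_lt_mul_of_pos_left
        (Real.arsinh_lt_arsinh.2 (mul_lt_mul_of_neg_right (h_exp hst) h_sinh)) h_inv
    · rw [hf]
      exact mul_neg_of_pos_of_neg h_inv
        (Real.arsinh_neg_iff.2 (mul_neg_of_pos_of_neg (Real.exp_pos _) h_sinh))
end

section
/- Let k be a positive natural number and let a_1,…,a_k and b_1,…,b_k be positive real numbers. Consider the vector field F on ℝ^k defined by F(u)_j = −a_j·b_j·tanh(a_j·u_j). Then F(u) = 0 if and only if u = 0, and for every u₀ ∈ ℝ^k the function u : ℝ → ℝ^k with u(t)_j = (1/a_j)·arsinh(e^{−a_j²·b_j·t}·sinh(a_j·(u₀)_j)) satisfies u(0) = u₀ and u′(t) = F(u(t)) for all t ∈ ℝ, and u(t) tends to 0 as t → ∞. -/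
/-- A curve in a finite-dimensional Euclidean space has a derivative as soon as each of its
coordinates does. -/
theorem hasDerivAt_euclideanSpace_of_coord {ι : Type*} [Fintype ι] {u : ℝ → EuclideanSpace ℝ ι}
    {u' : EuclideanSpace ℝ ι} {t : ℝ} (h : ∀ j, HasDerivAt (fun s => u s j) (u' j) t) :
    HasDerivAt u u' t :=
  (PiLp.continuousLinearEquiv 2 ℝ (fun _ : ι => ℝ)).symm.hasFDerivAt.comp_hasDerivAt t
    (hasDerivAt_pi.2 h)

/-- A curve in a finite-dimensional Euclidean space converges as soon as each of its
coordinates does. -/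
theorem tendsto_euclideanSpace_of_coord {α ι : Type*} [Fintype ι] {l : Filter α}
    {u : α → EuclideanSpace ℝ ι} {v : EuclideanSpace ℝ ι}
    (h : ∀ j, Filter.Tendsto (fun s => u s j) l (nhds (v j))) : Filter.Tendsto u l (nhds v) :=
  ((PiLp.continuous_toLp 2 (fun _ : ι => ℝ)).tendsto _).comp (tendsto_pi_nhds.2 h)

theorem Real.tanh_eq_zero_iff {x : ℝ} : Real.tanh x = 0 ↔ x = 0 :=
  Real.tanh_injective.eq_iff' Real.tanh_zero

/-- The explicit solution of the scalar equation `y' = -(a * b * tanh (a * y))`. -/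
theorem hasDerivAt_arsinh_exp_mul {a : ℝ} (ha : a ≠ 0) (b c t : ℝ) :
    HasDerivAt (fun s => (1 / a) * Real.arsinh (Real.exp (-(a ^ 2 * b * s)) * c))
      (-(a * b * Real.tanh (a * ((1 / a) * Real.arsinh (Real.exp (-(a ^ 2 * b * t)) * c))))) t := by
  have h := ((((((hasDerivAt_id t).const_mul (a ^ 2 * b)).neg).exp).mul_const c).arsinh).const_mul
    (1 / a)
  refine h.congr_deriv ?_
  rw [← mul_assoc, mul_one_div_cancel ha, one_mul, Real.tanh_arsinh]
  simp only [smul_eq_mul, id, Pi.neg_apply]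
  field_simp

/-- For positive rate, the explicit scalar solution decays to zero. -/
theorem tendsto_arsinh_exp_mul {r : ℝ} (hr : 0 < r) (a c : ℝ) :
    Filter.Tendsto (fun s => (1 / a) * Real.arsinh (Real.exp (-(r * s)) * c))
      Filter.atTop (nhds 0) := by
  have h : Filter.Tendsto (fun s : ℝ => Real.exp (-(r * s))) Filter.atTop (nhds 0) :=
    Real.tendsto_exp_neg_atTop_nhds_zero.comp (Filter.tendsto_id.const_mul_atTop hr)
  simpa using ((h.mul_const c).arsinh).const_mul (1 / a)

/-- For the vector field `F(u)_j = −a_j·b_j·tanh(a_j·u_j)` on `ℝ^k`: `F u = 0 ↔ u = 0`, and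
the explicit curve `u(t)_j = (1/a_j)·arsinh(e^{−a_j²b_j t}·sinh(a_j·(u₀)_j))` is an integral
curve through `u₀` that tends to `0` as `t → ∞`. -/
theorem stmt_7 (k : ℕ) (hk : 0 < k) (a b : Fin k → ℝ)
    (ha : ∀ j, 0 < a j) (hb : ∀ j, 0 < b j)
    (F : EuclideanSpace ℝ (Fin k) → EuclideanSpace ℝ (Fin k))
    (hF : ∀ w j, F w j = -(a j * b j * Real.tanh (a j * w j)))
    (u₀ : EuclideanSpace ℝ (Fin k)) (u : ℝ → EuclideanSpace ℝ (Fin k))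
    (hu : ∀ t j, u t j =
      (1 / a j) * Real.arsinh (Real.exp (-(a j ^ 2 * b j * t)) * Real.sinh (a j * u₀ j))) :
    (∀ w, F w = 0 ↔ w = 0) ∧ u 0 = u₀ ∧ (∀ t, HasDerivAt u (F (u t)) t) ∧
      Filter.Tendsto u Filter.atTop (nhds 0) := by
  refine ⟨fun w => ?_, ?_, fun t => ?_, ?_⟩
  · simp only [PiLp.ext_iff, hF, PiLp.zero_apply, neg_eq_zero, mul_eq_zero,
      Real.tanh_eq_zero_iff, (ha _).ne', (hb _).ne', false_or]
  · ext j
    have := (ha j).ne'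
    simp [hu, this]
  · refine hasDerivAt_euclideanSpace_of_coord fun j => ?_
    simp only [hF, hu]
    exact hasDerivAt_arsinh_exp_mul (ha j).ne' _ _ t
  · refine tendsto_euclideanSpace_of_coord fun j => ?_
    simp only [hu]
    exact tendsto_arsinh_exp_mul (mul_pos (pow_pos (ha j) 2) (hb j)) _ _
end

section
/- Let m and k be positive natural numbers, v ∈ ℝ^m a fixed vector, and a_1,…,a_k and b_1,…,b_k positive real numbers. Consider the vector field Z on ℝ^m × ℝ^k defined by Z(s,u) = (v, (−a_j·b_j·tanh(a_j·u_j))_{j=1,…,k}). Then for every (s₀,u₀) ∈ ℝ^m × ℝ^k, the curve c(t) = (s₀ + t·v, ((1/a_j)·arsinh(e^{−a_j²·b_j·t}·sinh(a_j·(u₀)_j)))_{j=1,…,k}) is defined for all t ∈ ℝ, satisfies c(0) = (s₀,u₀) and c′(t) = Z(c(t)) for all t ∈ ℝ, and is the unique differentiable curve with these properties. -/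
/-- A curve in Euclidean space is differentiated coordinatewise. -/
theorem hasDerivAt_euclidean {ι : Type*} [Fintype ι] {f : ℝ → EuclideanSpace ℝ ι}
    {f' : EuclideanSpace ℝ ι} {t : ℝ} :
    HasDerivAt f f' t ↔ ∀ i, HasDerivAt (fun t => f t i) (f' i) t := by
  simp only [← hasDerivWithinAt_univ, hasDerivWithinAt_iff_hasFDerivWithinAt]
  rw [hasFDerivWithinAt_euclidean]
  refine forall_congr' fun i => iff_of_eq ?_
  congr 1

/-- The curve `t ↦ (1/a)·arsinh(e^{−a²bt}·sinh(a·x))` solves `u' = −a·b·tanh(a·u)`. -/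
theorem hasDerivAt_arsinh_exp_mul_sinh {a : ℝ} (ha : a ≠ 0) (b x t : ℝ) :
    HasDerivAt
      (fun t => (1 / a) * Real.arsinh (Real.exp (-(a ^ 2 * b * t)) * Real.sinh (a * x)))
      (-(a * b * Real.tanh (a * ((1 / a) *
        Real.arsinh (Real.exp (-(a ^ 2 * b * t)) * Real.sinh (a * x)))))) t := by
  have hlin : HasDerivAt (fun t : ℝ => -(a ^ 2 * b * t)) (-(a ^ 2 * b)) t := by
    simpa using (hasDerivAt_id t).const_mul (a ^ 2 * b) |>.fun_neg
  have h := ((hlin.exp.mul_const (Real.sinh (a * x))).arsinh).const_mul (1 / a)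
  refine h.congr_deriv ?_
  rw [← mul_assoc a (1 / a), mul_one_div_cancel ha, one_mul, Real.tanh_arsinh, smul_eq_mul]
  field_simp

/-- Along every solution of `u' = −a·b·tanh(a·u)` the quantity `e^{a²bt}·sinh(a·u)` is constant,
which determines the solution. -/
theorem eq_arsinh_exp_mul_sinh_of_hasDerivAt {a : ℝ} (ha : a ≠ 0) (b : ℝ) {u : ℝ → ℝ}
    (hu : ∀ t, HasDerivAt u (-(a * b * Real.tanh (a * u t))) t) (t : ℝ) :
    u t = (1 / a) * Real.arsinh (Real.exp (-(a ^ 2 * b * t)) * Real.sinh (a * u 0)) := by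
  have hw : ∀ t, HasDerivAt (fun t => Real.exp (a ^ 2 * b * t) * Real.sinh (a * u t)) 0 t := by
    intro t
    have hlin : HasDerivAt (fun t : ℝ => a ^ 2 * b * t) (a ^ 2 * b) t := by
      simpa using (hasDerivAt_id t).const_mul (a ^ 2 * b)
    refine (hlin.exp.mul ((hu t).const_mul a).sinh).congr_deriv ?_
    have hcosh := (Real.cosh_pos (a * u t)).ne'
    rw [Real.tanh_eq_sinh_div_cosh]
    field_simp
    ring
  have hconst := is_const_of_deriv_eq_zero (fun t => (hw t).differentiableAt)
    (fun t => (hw t).deriv) t 0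
  simp only [mul_zero, Real.exp_zero, one_mul] at hconst
  rw [← hconst, ← mul_assoc, ← Real.exp_add, neg_add_cancel, Real.exp_zero, one_mul,
    Real.arsinh_sinh, ← mul_assoc, one_div_mul_cancel ha, one_mul]

/-- A curve with constant derivative `v` is affine. -/
theorem eq_add_smul_of_hasDerivAt_const {E : Type*} [NormedAddCommGroup E] [NormedSpace ℝ E]
    {v : E} {s : ℝ → E} (hs : ∀ t, HasDerivAt s v t) (t : ℝ) : s t = s 0 + t • v := by
  have hw : ∀ t, HasDerivAt (fun t => s t - t • v) 0 t := fun t => by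
    simpa using (hs t).fun_sub ((hasDerivAt_id t).smul_const v)
  have hconst := is_const_of_deriv_eq_zero (fun t => (hw t).differentiableAt)
    (fun t => (hw t).deriv) t 0
  simpa [sub_eq_iff_eq_add] using hconst

/-- On `ℝ^m × ℝ^k` with vector field `Z(s,u) = (v, (−a_j·b_j·tanh(a_j·u_j))_j)`, the curve
`c(t) = (s₀ + t·v, ((1/a_j)·arsinh(e^{−a_j²b_j t}·sinh(a_j·(u₀)_j)))_j)` is the unique
integral curve of `Z` with `c 0 = (s₀, u₀)`, defined for all `t ∈ ℝ`. -/
theorem stmt_8 (m k : ℕ) (hm : 0 < m) (hk : 0 < k)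
    (v : EuclideanSpace ℝ (Fin m)) (a b : Fin k → ℝ)
    (ha : ∀ j, 0 < a j) (hb : ∀ j, 0 < b j)
    (Z : EuclideanSpace ℝ (Fin m) × EuclideanSpace ℝ (Fin k) →
      EuclideanSpace ℝ (Fin m) × EuclideanSpace ℝ (Fin k))
    (hZ : ∀ p, (Z p).1 = v ∧ ∀ j, (Z p).2 j = -(a j * b j * Real.tanh (a j * p.2 j)))
    (s₀ : EuclideanSpace ℝ (Fin m)) (u₀ : EuclideanSpace ℝ (Fin k))
    (c : ℝ → EuclideanSpace ℝ (Fin m) × EuclideanSpace ℝ (Fin k))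
    (hc : ∀ t, (c t).1 = s₀ + t • v ∧ ∀ j, (c t).2 j =
      (1 / a j) * Real.arsinh (Real.exp (-(a j ^ 2 * b j * t)) * Real.sinh (a j * u₀ j))) :
    c 0 = (s₀, u₀) ∧ (∀ t, HasDerivAt c (Z (c t)) t) ∧
      ∀ d : ℝ → EuclideanSpace ℝ (Fin m) × EuclideanSpace ℝ (Fin k),
        Differentiable ℝ d → d 0 = (s₀, u₀) → (∀ t, HasDerivAt d (Z (d t)) t) → d = c := by
  have hc₀ : c 0 = (s₀, u₀) := by
    refine Prod.ext (by simp [(hc 0).1]) (PiLp.ext fun j => ?_)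
    rw [(hc 0).2 j]
    simp [Real.arsinh_sinh, (ha j).ne']
  refine ⟨hc₀, fun t => ?_, fun d _ hd₀ hd => ?_⟩
  · have hfst : HasDerivAt (fun t => (c t).1) (Z (c t)).1 t := by
      rw [(hZ (c t)).1, funext fun t => (hc t).1]
      simpa using ((hasDerivAt_id t).smul_const v).const_add s₀
    have hsnd : HasDerivAt (fun t => (c t).2) (Z (c t)).2 t := by
      refine hasDerivAt_euclidean.2 fun j => ?_
      rw [(hZ (c t)).2 j, funext fun t => (hc t).2 j, (hc t).2 j]
      exact hasDerivAt_arsinh_exp_mul_sinh (ha j).ne' (b j) (u₀ j) t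
    exact hfst.prodMk hsnd
  · funext t
    refine Prod.ext ?_ (PiLp.ext fun j => ?_)
    · have hfst : ∀ t, HasDerivAt (fun t => (d t).1) v t := fun t =>
        (hZ (d t)).1 ▸ (hd t).fst
      rw [(hc t).1, eq_add_smul_of_hasDerivAt_const hfst t, hd₀]
    · have hsnd : ∀ t, HasDerivAt (fun t => (d t).2 j)
          (-(a j * b j * Real.tanh (a j * (d t).2 j))) t := fun t =>
        (hZ (d t)).2 j ▸ hasDerivAt_euclidean.1 (hd t).snd j
      rw [(hc t).2 j, eq_arsinh_exp_mul_sinh_of_hasDerivAt (ha j).ne' (b j) hsnd t, hd₀]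
end

section
/- Let m and k be positive natural numbers, v ∈ ℝ^m, and a_1,…,a_k and b_1,…,b_k positive real numbers. For (s₀,u₀) ∈ ℝ^m × ℝ^k let c(t) = (s₀ + t·v, ((1/a_j)·arsinh(e^{−a_j²·b_j·t}·sinh(a_j·(u₀)_j)))_j) and let ĉ(t) = (s₀ + t·v, 0) be the corresponding curve with initial value (s₀,0). Then for every t ∈ ℝ, the Euclidean distance between c(t) and ĉ(t) equals √(Σ_{j=1}^k (1/a_j²)·arsinh²(e^{−a_j²·b_j·t}·sinh(a_j·(u₀)_j))), and this distance tends to 0 as t → ∞. -/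
/-- The Euclidean distance between the integral curve through `(s₀,u₀)` and the straight-line
curve through `(s₀,0)` equals `√(Σ_j (1/a_j²)·arsinh²(e^{−a_j²b_j t}·sinh(a_j·(u₀)_j)))`,
and it tends to `0` as `t → ∞`. -/
theorem stmt_10 (m k : ℕ) (hm : 0 < m) (hk : 0 < k)
    (v s₀ : Fin m → ℝ) (a b : Fin k → ℝ)
    (ha : ∀ j, 0 < a j) (hb : ∀ j, 0 < b j) (u₀ : Fin k → ℝ)
    (c chat : ℝ → EuclideanSpace ℝ (Fin m ⊕ Fin k))
    (hc : ∀ t, (∀ i, c t (Sum.inl i) = s₀ i + t * v i) ∧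
      ∀ j, c t (Sum.inr j) =
        (1 / a j) * Real.arsinh (Real.exp (-(a j ^ 2 * b j * t)) * Real.sinh (a j * u₀ j)))
    (hchat : ∀ t, (∀ i, chat t (Sum.inl i) = s₀ i + t * v i) ∧ ∀ j, chat t (Sum.inr j) = 0) :
    (∀ t, dist (c t) (chat t) = Real.sqrt (∑ j : Fin k, (1 / (a j) ^ 2) *
      Real.arsinh (Real.exp (-(a j ^ 2 * b j * t)) * Real.sinh (a j * u₀ j)) ^ 2)) ∧
      Filter.Tendsto (fun t => dist (c t) (chat t)) Filter.atTop (nhds 0) := by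
  have hdist : ∀ t, dist (c t) (chat t) = Real.sqrt (∑ j : Fin k, (1 / (a j) ^ 2) *
      Real.arsinh (Real.exp (-(a j ^ 2 * b j * t)) * Real.sinh (a j * u₀ j)) ^ 2) := by
    intro t
    rw [EuclideanSpace.dist_eq, Fintype.sum_sum_type]
    simp [(hc t).1, (hc t).2, (hchat t).1, (hchat t).2, mul_pow]
  refine ⟨hdist, ?_⟩
  simp_rw [hdist]
  have hexp (j : Fin k) :
      Filter.Tendsto (fun t => Real.exp (-(a j ^ 2 * b j * t))) Filter.atTop (nhds 0) :=
    Real.tendsto_exp_neg_atTop_nhds_zero.comp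
      (Filter.tendsto_id.const_mul_atTop (mul_pos (pow_pos (ha j) 2) (hb j)))
  have hterm (j : Fin k) : Filter.Tendsto (fun t => (1 / (a j) ^ 2) *
      Real.arsinh (Real.exp (-(a j ^ 2 * b j * t)) * Real.sinh (a j * u₀ j)) ^ 2)
      Filter.atTop (nhds 0) := by
    simpa only [zero_mul, Real.arsinh_zero, zero_pow two_ne_zero, mul_zero] using
      ((((hexp j).mul_const (Real.sinh (a j * u₀ j))).arsinh).pow 2).const_mul
      (1 / (a j) ^ 2)
  simpa using (tendsto_finsetSum Finset.univ fun j _ => hterm j).sqrt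
end

section
/- Let k be a positive natural number and a_1,…,a_k, b_1,…,b_k positive real numbers, and set μ = min_j a_j²·b_j. For u₀ ∈ ℝ^k define u : ℝ → ℝ^k by u(t)_j = (1/a_j)·arsinh(e^{−a_j²·b_j·t}·sinh(a_j·(u₀)_j)). Then for every t ≥ 0, ‖u(t)‖ ≤ e^{−μ·t}·√(Σ_{j=1}^k sinh²(a_j·(u₀)_j)/a_j²); in particular u(t) converges to 0 exponentially fast as t → ∞. -/
/-- The inverse hyperbolic sine is dominated by the identity in absolute value. -/
theorem abs_arsinh_le_abs (x : ℝ) : |Real.arsinh x| ≤ |x| := by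
  calc |Real.arsinh x| ≤ Real.sinh |Real.arsinh x| := Real.self_le_sinh_iff.2 (abs_nonneg _)
    _ = |x| := by rw [← Real.abs_sinh, Real.sinh_arsinh]


/-- Quantitative exponential convergence: with `μ = min_j a_j²·b_j`, the explicit solution
satisfies `‖u(t)‖ ≤ e^{−μt}·√(Σ_j sinh²(a_j·(u₀)_j)/a_j²)` for `t ≥ 0`; in particular
`u(t) → 0` as `t → ∞`. -/
theorem stmt_12 (k : ℕ) (hk : 0 < k) (a b : Fin k → ℝ)
    (ha : ∀ j, 0 < a j) (hb : ∀ j, 0 < b j)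
    (μ : ℝ) (hμ : μ = ⨅ j, a j ^ 2 * b j)
    (u₀ : Fin k → ℝ) (u : ℝ → EuclideanSpace ℝ (Fin k))
    (hu : ∀ t j, u t j =
      (1 / a j) * Real.arsinh (Real.exp (-(a j ^ 2 * b j * t)) * Real.sinh (a j * u₀ j))) :
    (∀ t ≥ (0 : ℝ), ‖u t‖ ≤ Real.exp (-(μ * t)) *
      Real.sqrt (∑ j : Fin k, Real.sinh (a j * u₀ j) ^ 2 / a j ^ 2)) ∧
      Filter.Tendsto u Filter.atTop (nhds 0) := by
  have : Nonempty (Fin k) := ⟨⟨0, hk⟩⟩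
  have hμ_le : ∀ j, μ ≤ a j ^ 2 * b j := fun j => by
    rw [hμ]
    exact ciInf_le (Set.finite_range _).bddBelow j
  have hμ_pos : 0 < μ := by
    obtain ⟨j, hj⟩ := exists_eq_ciInf_of_finite (f := fun j => a j ^ 2 * b j)
    rw [hμ, ← hj]
    exact mul_pos (pow_pos (ha j) 2) (hb j)
  have hbound : ∀ t ≥ (0 : ℝ), ‖u t‖ ≤ Real.exp (-(μ * t)) *
      Real.sqrt (∑ j : Fin k, Real.sinh (a j * u₀ j) ^ 2 / a j ^ 2) := by
    intro t ht
    rw [EuclideanSpace.norm_eq, ← Real.sqrt_sq (Real.exp_pos (-(μ * t))).le,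
      ← Real.sqrt_mul (sq_nonneg _), Finset.mul_sum]
    refine Real.sqrt_le_sqrt (Finset.sum_le_sum fun j _ => ?_)
    have hj : ‖u t j‖ ≤ Real.exp (-(μ * t)) * (|Real.sinh (a j * u₀ j)| / a j) := by
      rw [hu, Real.norm_eq_abs, abs_mul, abs_of_pos (one_div_pos.2 (ha j))]
      calc 1 / a j * |Real.arsinh (Real.exp (-(a j ^ 2 * b j * t)) * Real.sinh (a j * u₀ j))|
          ≤ 1 / a j * |Real.exp (-(a j ^ 2 * b j * t)) * Real.sinh (a j * u₀ j)| :=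
            mul_le_mul_of_nonneg_left (abs_arsinh_le_abs _) (one_div_pos.2 (ha j)).le
        _ = Real.exp (-(a j ^ 2 * b j * t)) * (|Real.sinh (a j * u₀ j)| / a j) := by
            rw [abs_mul, Real.abs_exp]
            ring
        _ ≤ _ := by
            refine mul_le_mul_of_nonneg_right (Real.exp_le_exp.2 (neg_le_neg ?_))
              (div_nonneg (abs_nonneg _) (ha j).le)
            exact mul_le_mul_of_nonneg_right (hμ_le j) ht
    calc ‖u t j‖ ^ 2 ≤ (Real.exp (-(μ * t)) * (|Real.sinh (a j * u₀ j)| / a j)) ^ 2 :=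
          pow_le_pow_left₀ (norm_nonneg _) hj 2
      _ = _ := by rw [mul_pow, div_pow, sq_abs]
  refine ⟨hbound, squeeze_zero_norm' ((Filter.eventually_ge_atTop 0).mono hbound) ?_⟩
  rw [← zero_mul (Real.sqrt (∑ j : Fin k, Real.sinh (a j * u₀ j) ^ 2 / a j ^ 2))]
  exact (Real.tendsto_exp_neg_atTop_nhds_zero.comp
    (Filter.tendsto_id.const_mul_atTop hμ_pos)).mul_const _
end
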